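/- arXiv:2303.15829 — 3 statements merged into one kernel-verified Lean document; each statement's English description precedes it below -/
import Mathlib

section
/- Let F be a field and let R ⊆ S be valuation subrings of F (so each is a subring of F such that for every nonzero t ∈ F, t or t⁻¹ lies in it; both have fraction field F). Then for any two S-algebras A and B, for all a ∈ A, b ∈ B and s ∈ S one has (s·a) ⊗ b = a ⊗ (s·b) in A ⊗_R B; consequently the canonical surjective ring homomorphism A ⊗_R B → A ⊗_S B is an isomorphism. -/
open scoped TensorProduct

/-- If every element of `S` is either the image of an element of `R` or has an inverse which is,
then scalars from `S` move across tensor products over `R`. -/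
theorem TensorProduct.compatibleSMul_of_forall_algebraMap_or_inv {R S : Type*} [CommRing R]
    [CommRing S] [Algebra R S]
    (h : ∀ s : S, ∃ r : R, algebraMap R S r = s ∨ algebraMap R S r * s = 1)
    (M N : Type*) [AddCommGroup M] [AddCommGroup N] [Module R M] [Module S M] [Module R N]
    [Module S N] [IsScalarTower R S M] [IsScalarTower R S N] :
    TensorProduct.CompatibleSMul R S M N where
  smul_tmul s m n := by
    obtain ⟨r, rfl | hr⟩ := h s
    · simp only [algebraMap_smul, TensorProduct.smul_tmul]
    · have hm : r • s • m = m := by rw [← algebraMap_smul S, ← mul_smul, hr, one_smul]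
      have hn : r • s • n = n := by rw [← algebraMap_smul S, ← mul_smul, hr, one_smul]
      calc (s • m) ⊗ₜ[R] n = (s • m) ⊗ₜ[R] (r • s • n) := by rw [hn]
        _ = m ⊗ₜ[R] (s • n) := by rw [← TensorProduct.smul_tmul, hm]

/-- Let `F` be a field and `R ⊆ S` valuation subrings of `F`. Then for any two
`S`-algebras `A` and `B` (viewed as `R`-algebras by restriction of scalars), one has
`(s • a) ⊗ b = a ⊗ (s • b)` in `A ⊗[R] B` for all `a ∈ A`, `b ∈ B`, `s ∈ S`; consequently the
canonical surjective ring homomorphism `A ⊗[R] B → A ⊗[S] B` is an isomorphism (bijective). -/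
theorem valuation_subring_tensor_eq {F : Type*} [Field F] (R S : Subring F)
    (hR : ∀ t : F, t ≠ 0 → t ∈ R ∨ t⁻¹ ∈ R)
    (hS : ∀ t : F, t ≠ 0 → t ∈ S ∨ t⁻¹ ∈ S)
    (hRS : R ≤ S)
    (A B : Type*) [CommRing A] [CommRing B]
    [Algebra R A] [Algebra S A] [Algebra R B] [Algebra S B]
    (hA : algebraMap R A = (algebraMap S A).comp (Subring.inclusion hRS))
    (hB : algebraMap R B = (algebraMap S B).comp (Subring.inclusion hRS)) :
    (∀ (s : S) (a : A) (b : B), (s • a) ⊗ₜ[R] b = a ⊗ₜ[R] (s • b)) ∧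
    ∃ φ : (A ⊗[R] B) →+* (A ⊗[S] B),
      (∀ (a : A) (b : B), φ (a ⊗ₜ[R] b) = a ⊗ₜ[S] b) ∧ Function.Bijective φ := by
  let _ : Algebra R S := (Subring.inclusion hRS).toAlgebra
  have _ : IsScalarTower R S A := .of_algebraMap_eq' hA
  have _ : IsScalarTower R S B := .of_algebraMap_eq' hB
  have _ : TensorProduct.CompatibleSMul R S A B := by
    refine TensorProduct.compatibleSMul_of_forall_algebraMap_or_inv (fun s ↦ ?_) A B
    by_cases hs : (s : F) = 0
    · exact ⟨0, .inl (Subtype.ext (by simp [hs]))⟩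
    · obtain h | h := hR s hs
      · exact ⟨⟨s, h⟩, .inl rfl⟩
      · exact ⟨⟨_, h⟩, .inr (Subtype.ext (inv_mul_cancel₀ hs))⟩
  let e := Algebra.TensorProduct.equivOfCompatibleSMul S R R A B
  exact ⟨TensorProduct.smul_tmul, (e : A ⊗[R] B →+* A ⊗[S] B), fun _ _ ↦ rfl,
    e.bijective⟩
end

section
/- Let R be a valuation ring with fraction field F, let K be a field extension of F, let S be a valuation subring of K containing R, and let A be a flat R-algebra. If the K-algebra A ⊗_R K is an integral domain, then A ⊗_R S is an integral domain. -/
open scoped TensorProduct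

/-- Let `R` be a valuation ring with fraction field `F`, let `K` be a field
extension of `F`, let `S` be a valuation subring of `K` containing (the image of) `R`, and let
`A` be a flat `R`-algebra. If the `K`-algebra `A ⊗[R] K` is an integral domain, then `A ⊗[R] S`
is an integral domain. -/
theorem isDomain_tensor_valuationSubring_of_isDomain_tensor_field
    (R : Type*) [CommRing R] [IsDomain R] [ValuationRing R]
    (F : Type*) [Field F] [Algebra R F] [IsFractionRing R F]
    (K : Type*) [Field K] [Algebra F K] [Algebra R K] [IsScalarTower R F K]
    (S : Subring K)
    (hS : ∀ t : K, t ≠ 0 → t ∈ S ∨ t⁻¹ ∈ S)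
    (hRS : ∀ r : R, algebraMap R K r ∈ S)
    [Algebra R S] (hcomp : ∀ r : R, (algebraMap R S r : K) = algebraMap R K r)
    (A : Type*) [CommRing A] [Algebra R A] [Module.Flat R A]
    (hdom : IsDomain (A ⊗[R] K)) : IsDomain (A ⊗[R] S) := by
  let f : S →ₐ[R] K := { S.subtype with commutes' := hcomp }
  have hf : Function.Injective f := Subtype.val_injective
  have hinj : Function.Injective (Algebra.TensorProduct.map (AlgHom.id R A) f) :=
    Module.Flat.lTensor_preserves_injective_linearMap (M := A) f.toLinearMap hf
  exact hinj.isDomain (Algebra.TensorProduct.map (AlgHom.id R A) f)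
end

section
/- Let R be a valuation ring and let A be an R-algebra which is flat over R and of finite type over R. Then A is of finite presentation over R. -/
/-- A submodule of a finite module over a valuation ring is finitely generated as soon as the
quotient is torsion-free. -/
theorem Submodule.fg_of_smul_mem_imp_mem {R M : Type*} [CommRing R] [IsDomain R] [ValuationRing R]
    [AddCommGroup M] [Module R M] [Module.Finite R M] (N : Submodule R M)
    (hN : ∀ r : R, r ≠ 0 → ∀ x, r • x ∈ N → x ∈ N) : N.FG := by
  have hflat : Module.Flat R (M ⧸ N) := by
    rw [Module.Flat.flat_iff_torsion_eq_bot_of_isBezout, eq_bot_iff]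
    rintro x ⟨⟨r, hr⟩, hx⟩
    obtain ⟨y, rfl⟩ := N.mkQ_surjective x
    have hy : r • N.mkQ y = 0 := hx
    rw [← map_smul, Submodule.mkQ_apply, Submodule.Quotient.mk_eq_zero] at hy
    rw [Submodule.mem_bot, Submodule.mkQ_apply, Submodule.Quotient.mk_eq_zero]
    exact hN r (nonZeroDivisors.ne_zero hr) y hy
  have hfree : Module.Free R (M ⧸ N) := Module.free_of_flat_of_isLocalRing
  have hfp : Module.FinitePresentation R (M ⧸ N) :=
    Module.finitePresentation_of_projective R (M ⧸ N)
  simpa using Module.FinitePresentation.fg_ker N.mkQ N.mkQ_surjective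

namespace MvPolynomial

/-- Over a valuation ring, a polynomial whose coefficients lie in the maximal ideal is divisible by
a constant in the maximal ideal. -/
theorem exists_eq_C_mul_of_map_residue_eq_zero {σ R : Type*} [CommRing R] [IsDomain R]
    [ValuationRing R] {h : MvPolynomial σ R} (hh : map (IsLocalRing.residue R) h = 0) :
    ∃ r ∈ IsLocalRing.maximalIdeal R, ∃ g, h = C r * g := by
  classical
  have hfg : (Ideal.span (h.support.image fun s ↦ coeff s h : Set R)).FG := ⟨_, rfl⟩
  obtain ⟨r, hr⟩ := (IsBezout.isPrincipal_of_FG _ hfg).principal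
  rw [Ideal.submodule_span_eq] at hr
  refine ⟨r, ?_, ?_⟩
  · have hle : Ideal.span (h.support.image fun s ↦ coeff s h : Set R) ≤
        IsLocalRing.maximalIdeal R := by
      rw [Ideal.span_le]
      intro x hx
      obtain ⟨s, -, rfl⟩ := Finset.mem_image.1 (Finset.mem_coe.1 hx)
      have hs := congrArg (coeff s) hh
      rw [coeff_map, coeff_zero] at hs
      exact (IsLocalRing.residue_eq_zero_iff _).1 hs
    exact hle (hr ▸ Ideal.mem_span_singleton_self r)
  · refine (C_dvd_iff_dvd_coeff r h).2 fun s ↦ ?_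
    by_cases hs : s ∈ h.support
    · rw [← Ideal.mem_span_singleton, ← hr]
      exact Ideal.subset_span (by simpa using ⟨s, by simpa using hs, rfl⟩)
    · rw [notMem_support_iff.1 hs]
      exact dvd_zero r

theorem map_homogeneousComponent {σ R S : Type*} [CommSemiring R] [CommSemiring S] (f : R →+* S)
    (n : ℕ) (p : MvPolynomial σ R) :
    map f (homogeneousComponent n p) = homogeneousComponent n (map f p) := by
  ext s
  simp only [coeff_map, coeff_homogeneousComponent]
  split_ifs <;> simp

theorem homogeneousComponent_mem_span {σ R : Type*} [CommRing R] {s : Set (MvPolynomial σ R)}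
    (hs : ∀ p ∈ s, ∃ n, p.IsHomogeneous n) {p : MvPolynomial σ R} (hp : p ∈ Ideal.span s) (n : ℕ) :
    homogeneousComponent n p ∈ Ideal.span s := by
  let := gradedAlgebra (σ := σ) (R := R)
  exact homogeneousComponent_mem_of_mem (Ideal.homogeneous_span _ s hs) hp n

/-- Over a valuation ring, a homogeneous ideal with torsion-free quotient is finitely generated. -/
theorem fg_of_homogeneousComponent_mem {σ R : Type*} [Finite σ] [CommRing R] [IsDomain R]
    [ValuationRing R] (J : Ideal (MvPolynomial σ R))
    (hhom : ∀ p ∈ J, ∀ n, homogeneousComponent n p ∈ J)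
    (hJ : ∀ r : R, r ≠ 0 → ∀ p, C r * p ∈ J → p ∈ J) : J.FG := by
  classical
  set π := map (σ := σ) (IsLocalRing.residue R) with hπ
  have hπs : Function.Surjective π := map_surjective _ IsLocalRing.residue_surjective
  let S : Set (MvPolynomial σ R) := {p | p ∈ J ∧ ∃ n, p.IsHomogeneous n}
  have hmap : J.map π ≤ Ideal.span (π '' S) := by
    rw [Ideal.map_le_iff_le_comap]
    intro p hp
    rw [Ideal.mem_comap, ← sum_homogeneousComponent p, map_sum]
    exact sum_mem fun n _ ↦ Ideal.subset_span
      ⟨_, ⟨hhom p hp n, n, homogeneousComponent_isHomogeneous n p⟩, rfl⟩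
  obtain ⟨T', hT'S, hT'⟩ := (Submodule.fg_span_iff_fg_span_finset_subset (π '' S)).1
    (IsNoetherian.noetherian (Ideal.span (π '' S)))
  obtain ⟨T, hTS, rfl⟩ := Finset.subset_set_image_iff.1 hT'S
  refine ⟨T, le_antisymm (Ideal.span_le.2 fun p hp ↦ (hTS hp).1) ?_⟩
  have hThom : ∀ p ∈ (T : Set (MvPolynomial σ R)), ∃ n, p.IsHomogeneous n :=
    fun p hp ↦ (hTS hp).2
  have hlift : ∀ p ∈ J, ∃ g ∈ Ideal.span (T : Set (MvPolynomial σ R)), π g = π p := by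
    intro p hp
    have h1 : π p ∈ Ideal.span (π '' S) := hmap (Ideal.mem_map_of_mem π hp)
    have h2 : π p ∈ Ideal.span (π '' (T : Set (MvPolynomial σ R))) := by
      have h3 := hT'.le h1
      rwa [Finset.coe_image] at h3
    rw [← Ideal.map_span, Ideal.mem_map_iff_of_surjective π hπs] at h2
    exact h2
  have hdeg : ∀ n, J.restrictScalars R ⊓ homogeneousSubmodule σ R n ≤
      (Ideal.span (T : Set (MvPolynomial σ R))).restrictScalars R := by
    intro n
    refine Submodule.le_of_le_smul_of_le_jacobson_bot ?_
      (IsLocalRing.maximalIdeal_le_jacobson ⊥) ?_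
    · have : Module.Finite R (homogeneousSubmodule σ R n) :=
        Module.Finite.of_fg (homogeneousSubmodule_fg σ R n)
      have h := Submodule.fg_of_smul_mem_imp_mem
        ((J.restrictScalars R).comap (homogeneousSubmodule σ R n).subtype) (by
          intro r hr x hx
          refine hJ r hr x ?_
          rw [← smul_eq_C_mul]
          exact hx)
      have h' := h.map (homogeneousSubmodule σ R n).subtype
      rwa [Submodule.map_comap_subtype, inf_comm] at h'
    · rintro p ⟨hp, hpn⟩
      obtain ⟨g, hg, hgp⟩ := hlift p hp
      have hgn := homogeneousComponent_mem_span hThom hg n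
      have hgJ : homogeneousComponent n g ∈ J :=
        (Ideal.span_le.2 fun p hp ↦ (hTS hp).1 : Ideal.span (T : Set _) ≤ J) hgn
      have hpn' : homogeneousComponent n p = p := homogeneousComponent_eq_self hpn
      have hker : π (p - homogeneousComponent n g) = 0 := by
        rw [map_sub, hπ, map_homogeneousComponent, ← hπ, hgp, hπ, ← map_homogeneousComponent,
          hpn', sub_self]
      obtain ⟨r, hr, q, hq⟩ := exists_eq_C_mul_of_map_residue_eq_zero hker
      have hq' : p - homogeneousComponent n g = r • homogeneousComponent n q := by
        rw [smul_eq_C_mul, ← homogeneousComponent_C_mul, ← hq, map_sub, hpn',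
          homogeneousComponent_eq_self (homogeneousComponent_isHomogeneous n g)]
      rw [← add_sub_cancel (homogeneousComponent n g) p, hq']
      refine Submodule.add_mem_sup hgn ?_
      by_cases hr0 : r = 0
      · simp [hr0]
      · refine Submodule.smul_mem_smul hr ⟨hJ r hr0 _ ?_, homogeneousComponent_mem n q⟩
        rw [← smul_eq_C_mul, ← hq']
        exact J.sub_mem hp hgJ
  intro p hp
  rw [← sum_homogeneousComponent p]
  exact sum_mem fun n _ ↦ hdeg n ⟨hhom p hp n, homogeneousComponent_mem n p⟩

section Homogenization

variable {σ R : Type*} [CommRing R]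

/-- The evaluation at `1` of the extra variable. -/
noncomputable def dehomogenize : MvPolynomial (Option σ) R →ₐ[R] MvPolynomial σ R :=
  aeval fun i ↦ i.elim 1 X

/-- The embedding of `R[x₀, x₁, …]` in `R[x₁, …][T]` with image the Rees algebra of the degree
filtration. -/
noncomputable def toRees : MvPolynomial (Option σ) R →ₐ[R] Polynomial (MvPolynomial σ R) :=
  aeval fun i ↦ Polynomial.C (i.elim 1 X) * Polynomial.X

theorem toRees_monomial (s : Option σ →₀ ℕ) (r : R) :
    toRees (monomial s r) =
      Polynomial.C (dehomogenize (monomial s r)) * Polynomial.X ^ s.degree := by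
  simp only [toRees, dehomogenize, aeval_monomial, mul_pow, Finsupp.prod, Finset.prod_mul_distrib,
    Finset.prod_pow_eq_pow_sum, map_mul, map_prod, map_pow, Finsupp.degree_apply, mul_assoc]
  rfl

theorem eval_one_toRees (p : MvPolynomial (Option σ) R) :
    (toRees p).eval 1 = dehomogenize p := by
  induction p using MvPolynomial.induction_on' with
  | monomial s r => simp [toRees_monomial]
  | add p q hp hq => simp [hp, hq]

theorem coeff_toRees_homogeneousComponent (p : MvPolynomial (Option σ) R) (n m : ℕ) :
    (toRees (homogeneousComponent n p)).coeff m = if m = n then (toRees p).coeff n else 0 := by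
  induction p using MvPolynomial.induction_on' with
  | monomial s r =>
    rw [homogeneousComponent_of_mem (isHomogeneous_monomial r rfl), toRees_monomial]
    by_cases hs : n = s.degree <;> by_cases hm : m = n <;>
      simp_all [toRees_monomial, Polynomial.coeff_X_pow]
  | add p q hp hq =>
    simp only [map_add, Polynomial.coeff_add, hp, hq]
    split_ifs <;> simp

theorem exists_toRees_eq (f : MvPolynomial σ R) :
    ∃ (n : ℕ) (p : MvPolynomial (Option σ) R),
      toRees p = Polynomial.C f * Polynomial.X ^ n := by
  induction f using MvPolynomial.induction_on with
  | C r => exact ⟨0, C r, by simp [toRees]⟩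
  | add f g hf hg =>
    obtain ⟨n, p, hp⟩ := hf
    obtain ⟨m, q, hq⟩ := hg
    refine ⟨n + m, p * X none ^ m + q * X none ^ n, ?_⟩
    have hX : toRees (X none : MvPolynomial (Option σ) R) = Polynomial.X := by simp [toRees]
    rw [map_add, map_mul, map_mul, map_pow, map_pow, hX, hp, hq, map_add]
    ring
  | mul_X f i hf =>
    obtain ⟨n, p, hp⟩ := hf
    refine ⟨n + 1, p * X (some i), ?_⟩
    have hX : toRees (X (some i) : MvPolynomial (Option σ) R) =
        Polynomial.C (X i) * Polynomial.X := by simp [toRees]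
    rw [map_mul, hX, hp, map_mul]
    ring

/-- Over a valuation ring, an ideal with torsion-free quotient in a polynomial ring in finitely many
variables is finitely generated. -/
theorem fg_of_C_mul_mem_imp_mem [Finite σ] [IsDomain R] [ValuationRing R]
    (I : Ideal (MvPolynomial σ R)) (hI : ∀ r : R, r ≠ 0 → ∀ p, C r * p ∈ I → p ∈ I) : I.FG := by
  let J : Ideal (MvPolynomial (Option σ) R) := (I.map Polynomial.C).comap toRees
  have hJmem (p : MvPolynomial (Option σ) R) : p ∈ J ↔ ∀ n, (toRees p).coeff n ∈ I :=
    Ideal.mem_map_C_iff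
  have hJ : J.FG := by
    refine fg_of_homogeneousComponent_mem J (fun p hp n ↦ ?_) fun r hr p hp ↦ ?_
    · rw [hJmem] at hp ⊢
      intro m
      rw [coeff_toRees_homogeneousComponent]
      split_ifs
      · exact hp n
      · exact I.zero_mem
    · rw [hJmem] at hp ⊢
      intro n
      refine hI r hr _ ?_
      have h := hp n
      rwa [← smul_eq_C_mul, map_smul, Polynomial.coeff_smul, smul_eq_C_mul] at h
  have hmap : J.map (dehomogenize : MvPolynomial (Option σ) R →ₐ[R] MvPolynomial σ R) = I := by
    refine le_antisymm (Ideal.map_le_iff_le_comap.2 fun p hp ↦ ?_) fun f hf ↦ ?_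
    · rw [Ideal.mem_comap, ← eval_one_toRees, Polynomial.eval_eq_sum]
      exact sum_mem fun n _ ↦ I.mul_mem_right _ ((hJmem p).1 hp n)
    · obtain ⟨n, p, hp⟩ := exists_toRees_eq f
      have hpf : dehomogenize p = f := by simp [← eval_one_toRees, hp]
      rw [← hpf]
      refine Ideal.mem_map_of_mem _ ((hJmem p).2 fun m ↦ ?_)
      rw [hp, Polynomial.coeff_C_mul_X_pow]
      split_ifs
      · exact hf
      · exact I.zero_mem
  exact hmap ▸ hJ.map _

end Homogenization

end MvPolynomial

/-- Nagata. Let `R` be a valuation ring and let `A` be an `R`-algebra which is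
flat over `R` and of finite type over `R`. Then `A` is of finite presentation over `R`. -/
theorem finitePresentation_of_flat_of_finiteType_over_valuationRing
    (R : Type*) [CommRing R] [IsDomain R] [ValuationRing R]
    (A : Type*) [CommRing A] [Algebra R A] [Module.Flat R A] [Algebra.FiniteType R A] :
    Algebra.FinitePresentation R A := by
  obtain ⟨n, f, hf⟩ := Algebra.FiniteType.iff_quotient_mvPolynomial''.1
    (inferInstance : Algebra.FiniteType R A)
  refine ⟨n, f, hf, MvPolynomial.fg_of_C_mul_mem_imp_mem _ fun r hr p hp ↦ ?_⟩
  have hp' : r • f p = 0 := by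
    rw [← map_smul, MvPolynomial.smul_eq_C_mul]
    exact hp
  exact (smul_eq_zero_iff_right hr).1 hp'
end
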